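/- arXiv:1703.08495 — 2 statements merged into one kernel-verified Lean document; each statement's English description precedes it below -/
import Mathlib

section
/- In the spin representation: identify the half-spin representation S₁₀ of Spin₁₀ with O ⊕ O (two copies of the complexified octonions) and the vector representation with C ⊕ O ⊕ C, with the equivariant quadratic map κ(u,v) = (N(u), uv, N(v)) where N is the octonion norm. Then for nonzero x = (u,v) ∈ O ⊕ O: (a) κ(x) = 0 if and only if x has rank one (i.e. x lies in the closed Spin₁₀ × C*-orbit of (u,0) with N(u) = 0); (b) the polarized map λ(x) = κ̃(x, ·) : O ⊕ O → C ⊕ O ⊕ C has rank 5 if x has rank one, and rank 9 otherwise. -/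
noncomputable section

/-- The complexified octonions, axiomatized as an 8-dimensional unital composition algebra
`(O, mul, e, N)` over `ℂ`: `mul` is a bilinear multiplication with unit `e` and `N` is a
nondegenerate multiplicative quadratic form (the octonion norm). -/
structure OctonionAlgebra (O : Type*) [AddCommGroup O] [Module ℂ O] where
  mul : O →ₗ[ℂ] O →ₗ[ℂ] O
  e : O
  N : QuadraticForm ℂ O
  dim_eq : Module.finrank ℂ O = 8
  one_mul : ∀ u : O, mul e u = u
  mul_one : ∀ u : O, mul u e = u
  N_one : N e = 1
  N_mul : ∀ u v : O, N (mul u v) = N u * N v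
  nondeg : LinearMap.BilinForm.Nondegenerate (QuadraticMap.polarBilin N)

variable {O : Type*} [AddCommGroup O] [Module ℂ O]

/-- The `Spin₁₀`-equivariant quadratic map `κ : 𝕆 ⊕ 𝕆 → ℂ ⊕ 𝕆 ⊕ ℂ`,
`κ(u,v) = (N(u), uv, N(v))`. -/
def kap (A : OctonionAlgebra O) (x : O × O) : ℂ × O × ℂ :=
  (A.N x.1, A.mul x.1 x.2, A.N x.2)

/-- The polarization `λ(x) = κ̃(x, ·)` of `κ`, a linear map `𝕆 ⊕ 𝕆 → ℂ ⊕ 𝕆 ⊕ ℂ`. -/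
def lam (A : OctonionAlgebra O) (x : O × O) : (O × O) →ₗ[ℂ] ℂ × O × ℂ :=
  LinearMap.prod
    ((2⁻¹ : ℂ) • ((QuadraticMap.polarBilin A.N x.1).comp (LinearMap.fst ℂ O O)))
    (LinearMap.prod
      ((2⁻¹ : ℂ) • (((A.mul x.1).comp (LinearMap.snd ℂ O O)) +
        ((A.mul.flip x.2).comp (LinearMap.fst ℂ O O))))
      ((2⁻¹ : ℂ) • ((QuadraticMap.polarBilin A.N x.2).comp (LinearMap.snd ℂ O O))))

namespace OctonionAlgebra

open QuadraticMap Module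

/-- The opposite composition algebra. -/
def op (A : OctonionAlgebra O) : OctonionAlgebra O where
  mul := A.mul.flip
  e := A.e
  N := A.N
  dim_eq := A.dim_eq
  one_mul := A.mul_one
  mul_one := A.one_mul
  N_one := A.N_one
  N_mul u v := by simpa [mul_comm] using A.N_mul v u
  nondeg := A.nondeg

/-- Octonion conjugation `u ↦ ū = B(u, 1) 1 - u`, where `B` is the polar form of the norm. -/
def conj (A : OctonionAlgebra O) : O →ₗ[ℂ] O :=
  ((polarBilin A.N).flip A.e).smulRight A.e - LinearMap.id

theorem conj_apply (A : OctonionAlgebra O) (u : O) :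
    A.conj u = polar A.N u A.e • A.e - u := rfl

theorem ext_polar (A : OctonionAlgebra O) {x y : O}
    (h : ∀ z, polar A.N x z = polar A.N y z) : x = y := by
  rw [← sub_eq_zero]
  refine A.nondeg.1 _ fun z => ?_
  simp [h z]

theorem exists_polar_ne_zero (A : OctonionAlgebra O) {x : O} (hx : x ≠ 0) :
    ∃ z, polar A.N x z ≠ 0 := by
  by_contra! h
  exact hx (A.ext_polar fun z => by simp [h z])

theorem polar_mul_mul_left (A : OctonionAlgebra O) (u a b : O) :
    polar A.N (A.mul u a) (A.mul u b) = A.N u * polar A.N a b := by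
  simp only [polar, ← map_add, A.N_mul]
  ring

theorem polar_mul_add_polar_mul (A : OctonionAlgebra O) (u w a b : O) :
    polar A.N (A.mul u a) (A.mul w b) + polar A.N (A.mul u b) (A.mul w a) =
      polar A.N u w * polar A.N a b := by
  have h := A.polar_mul_mul_left (u + w) a b
  have hu := A.polar_mul_mul_left u a b
  have hw := A.polar_mul_mul_left w a b
  rw [QuadraticMap.map_add A.N u w] at h
  simp only [map_add, LinearMap.add_apply, polar_add_left, polar_add_right] at h
  rw [polar_comm A.N (A.mul u b)]
  linear_combination h - hu - hw

/-- Left multiplication by `ū` is adjoint to left multiplication by `u`. -/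
theorem polar_mul_left (A : OctonionAlgebra O) (u a b : O) :
    polar A.N (A.mul u a) b = polar A.N a (A.mul (A.conj u) b) := by
  have h := A.polar_mul_add_polar_mul u A.e a b
  simp only [A.one_mul] at h
  simp only [conj_apply, map_sub, map_smul, LinearMap.sub_apply, LinearMap.smul_apply, A.one_mul,
    polar_sub_right, polar_smul_right, smul_eq_mul]
  rw [polar_comm A.N a (A.mul u b)]
  linear_combination h

theorem polar_one_one (A : OctonionAlgebra O) : polar A.N A.e A.e = 2 := by
  simp [polar_self, A.N_one]

theorem conj_conj (A : OctonionAlgebra O) (u : O) : A.conj (A.conj u) = u := by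
  simp only [conj_apply, polar_sub_left, polar_smul_left, A.polar_one_one, smul_eq_mul]
  module

theorem N_conj (A : OctonionAlgebra O) (u : O) : A.N (A.conj u) = A.N u := by
  have h : polar A.N (A.conj u) (A.conj u) = polar A.N u u := by
    simp only [conj_apply, polar_sub_left, polar_sub_right, polar_smul_left, polar_smul_right,
      A.polar_one_one, smul_eq_mul, polar_comm A.N A.e u]
    ring
  simpa [polar_self] using h

theorem conj_mul_mul (A : OctonionAlgebra O) (u a : O) :
    A.mul (A.conj u) (A.mul u a) = A.N u • a :=
  A.ext_polar fun z => by
    rw [A.polar_mul_left, A.conj_conj, A.polar_mul_mul_left, polar_smul_left, smul_eq_mul]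

theorem mul_conj_mul (A : OctonionAlgebra O) (u a : O) :
    A.mul u (A.mul (A.conj u) a) = A.N u • a := by
  simpa [A.conj_conj, A.N_conj] using A.conj_mul_mul (A.conj u) a

theorem conj_mul_mul_add (A : OctonionAlgebra O) (u w a : O) :
    A.mul (A.conj u) (A.mul w a) + A.mul (A.conj w) (A.mul u a) = polar A.N u w • a := by
  have h := A.conj_mul_mul (u + w) a
  rw [QuadraticMap.map_add A.N u w, add_smul, add_smul, ← A.conj_mul_mul u a,
    ← A.conj_mul_mul w a] at h
  simp only [map_add, LinearMap.add_apply] at h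
  rw [← sub_eq_zero] at h ⊢
  rw [← h]
  abel

/-- For a nonzero element `u`, every element killed by `u` is a left multiple of `ū`. -/
theorem exists_conj_mul_eq (A : OctonionAlgebra O) {u v : O} (hu : u ≠ 0)
    (h : A.mul u v = 0) : ∃ a, A.mul (A.conj u) a = v := by
  obtain ⟨w, hw⟩ := A.exists_polar_ne_zero hu
  refine ⟨(polar A.N u w)⁻¹ • A.mul w v, ?_⟩
  have := A.conj_mul_mul_add u w v
  rw [h, map_zero, add_zero] at this
  rw [map_smul, this, smul_smul, inv_mul_cancel₀ hw, one_smul]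

theorem ker_mul_conj (A : OctonionAlgebra O) {u : O} (hu : u ≠ 0) (hN : A.N u = 0) :
    LinearMap.ker (A.mul (A.conj u)) = LinearMap.range (A.mul u) := by
  ext v
  rw [LinearMap.mem_ker, LinearMap.mem_range]
  constructor
  · intro h
    have hu' : A.conj u ≠ 0 := fun h0 => hu (by rw [← A.conj_conj u, h0, map_zero])
    simpa only [A.conj_conj] using A.exists_conj_mul_eq hu' h
  · rintro ⟨a, rfl⟩
    rw [A.conj_mul_mul, hN, zero_smul]

theorem ker_mul_conj_eq_orthogonal (A : OctonionAlgebra O) (u : O) :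
    LinearMap.ker (A.mul (A.conj u)) =
      LinearMap.BilinForm.orthogonal (polarBilin A.N) (LinearMap.range (A.mul u)) := by
  ext v
  rw [LinearMap.mem_ker, LinearMap.BilinForm.mem_orthogonal_iff]
  constructor
  · rintro h _ ⟨a, rfl⟩
    change polar A.N (A.mul u a) v = 0
    rw [A.polar_mul_left, h, polar_zero_right]
  · intro h
    refine A.ext_polar fun z => ?_
    rw [polar_zero_left, polar_comm, ← A.polar_mul_left]
    exact h _ ⟨z, rfl⟩

theorem finrank_range_mul_of_N_eq_zero [FiniteDimensional ℂ O] (A : OctonionAlgebra O) {u : O}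
    (hu : u ≠ 0) (hN : A.N u = 0) : finrank ℂ (LinearMap.range (A.mul u)) = 4 := by
  have h := LinearMap.BilinForm.finrank_orthogonal A.nondeg (LinearMap.range (A.mul u))
  rw [← A.ker_mul_conj_eq_orthogonal, A.ker_mul_conj hu hN, A.dim_eq] at h
  omega

theorem finrank_range_mul_of_N_ne_zero (A : OctonionAlgebra O) {u : O}
    (hN : A.N u ≠ 0) : finrank ℂ (LinearMap.range (A.mul u)) = 8 := by
  have h : LinearMap.range (A.mul u) = ⊤ := LinearMap.range_eq_top.2 fun a =>
    ⟨A.mul (A.conj u) ((A.N u)⁻¹ • a), by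
      rw [A.mul_conj_mul, smul_smul, mul_inv_cancel₀ hN, one_smul]⟩
  rw [h, finrank_top, A.dim_eq]

/-- `y` is carried to `x` by a linear automorphism that intertwines `κ` with a linear automorphism
of its target. -/
def Conjugate (A : OctonionAlgebra O) (x y : O × O) : Prop :=
  ∃ (g : (O × O) ≃ₗ[ℂ] (O × O)) (h : (ℂ × O × ℂ) ≃ₗ[ℂ] (ℂ × O × ℂ)),
    x = g y ∧ ∀ z, kap A (g z) = h (kap A z)

theorem Conjugate.trans {A : OctonionAlgebra O} {x y z : O × O} (hxy : A.Conjugate x y)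
    (hyz : A.Conjugate y z) : A.Conjugate x z := by
  obtain ⟨g, h, rfl, H⟩ := hxy
  obtain ⟨g', h', rfl, H'⟩ := hyz
  exact ⟨g'.trans g, h'.trans h, rfl, fun w => by simp [H, H']⟩

theorem Conjugate.symm {A : OctonionAlgebra O} {x y : O × O} (hxy : A.Conjugate x y) :
    A.Conjugate y x := by
  obtain ⟨g, h, rfl, H⟩ := hxy
  refine ⟨g.symm, h.symm, by simp, fun z => ?_⟩
  rw [LinearEquiv.eq_symm_apply, ← H, LinearEquiv.apply_symm_apply]

/-- The exchange of the two isotropic lines of `ℂ ⊕ 𝕆 ⊕ ℂ`. -/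
def vectorSwap (O : Type*) [AddCommGroup O] [Module ℂ O] : (ℂ × O × ℂ) ≃ₗ[ℂ] (ℂ × O × ℂ) where
  toFun p := (p.2.2, p.2.1, p.1)
  invFun p := (p.2.2, p.2.1, p.1)
  map_add' _ _ := rfl
  map_smul' _ _ := rfl

theorem kap_op_swap (A : OctonionAlgebra O) (x : O × O) :
    kap A.op x.swap = vectorSwap O (kap A x) := rfl

theorem Conjugate.of_op {A : OctonionAlgebra O} {x y : O × O}
    (h : A.op.Conjugate x.swap y.swap) : A.Conjugate x y := by
  obtain ⟨g, h, hx, H⟩ := h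
  let s := LinearEquiv.prodComm ℂ O O
  refine ⟨(s.trans g).trans s, ((vectorSwap O).trans h).trans (vectorSwap O), ?_, fun z => ?_⟩
  · exact congrArg Prod.swap hx
  · have := H z.swap
    rw [kap_op_swap] at this
    exact (kap_op_swap A.op (g z.swap)).trans (congrArg (vectorSwap O) this)

theorem conjugate_add_conj_mul (A : OctonionAlgebra O) (a u v : O) :
    A.Conjugate (u, v + A.mul (A.conj u) a) (u, v) := by
  refine ⟨LinearEquiv.skewProd (.refl ℂ O) (.refl ℂ O) ((A.mul.flip a).comp A.conj),
    LinearEquiv.skewProd (.refl ℂ ℂ)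
      (LinearEquiv.skewProd (.refl ℂ O) (.refl ℂ ℂ) ((polarBilin A.N).flip a))
      ((LinearMap.toSpanSingleton ℂ (O × ℂ) (a, A.N a))), by simp, fun z => ?_⟩
  obtain ⟨u, v⟩ := z
  have h : polar A.N v (A.mul (A.conj u) a) = polar A.N (A.mul u v) a :=
    (A.polar_mul_left u v a).symm
  simp [kap, QuadraticMap.map_add A.N v, A.mul_conj_mul, A.N_mul, A.N_conj, h]
  ring

theorem conjugate_add_mul_conj (A : OctonionAlgebra O) (a u v : O) :
    A.Conjugate (u + A.mul a (A.conj v), v) (u, v) :=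
  .of_op (A.op.conjugate_add_conj_mul a v u)

theorem conjugate_of_N_ne_zero (A : OctonionAlgebra O) {u : O} (v : O) (hu : A.N u ≠ 0) :
    A.Conjugate (u, v) (u, 0) := by
  have h := A.conjugate_add_conj_mul ((A.N u)⁻¹ • A.mul u v) u 0
  rwa [map_smul, A.conj_mul_mul, smul_smul, inv_mul_cancel₀ hu, one_smul, zero_add] at h

theorem conjugate_of_mul_eq_zero (A : OctonionAlgebra O) {u v : O} (hu : u ≠ 0)
    (h : A.mul u v = 0) : A.Conjugate (u, v) (u, 0) := by
  obtain ⟨a, rfl⟩ := A.exists_conj_mul_eq hu h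
  simpa using A.conjugate_add_conj_mul a u 0

theorem exists_conjugate_left (A : OctonionAlgebra O) {x : O × O} (hx : x ≠ 0) :
    ∃ u, u ≠ 0 ∧ A.Conjugate x (u, 0) := by
  obtain ⟨u, v⟩ := x
  have ne_of_N {w : O} (hw : A.N w ≠ 0) : w ≠ 0 := fun h => hw (by rw [h, map_zero])
  by_cases hu : A.N u = 0
  swap
  · exact ⟨u, ne_of_N hu, A.conjugate_of_N_ne_zero v hu⟩
  have shift (a : O) (ha : A.N (u + A.mul a (A.conj v)) ≠ 0) :
      ∃ w, w ≠ 0 ∧ A.Conjugate (u, v) (w, 0) :=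
    ⟨_, ne_of_N ha, (A.conjugate_add_mul_conj a u v).symm.trans
      (A.conjugate_of_N_ne_zero v ha)⟩
  by_cases hv : A.N v = 0
  swap
  · refine shift ((A.N v)⁻¹ • A.mul (A.e - u) v) ?_
    have h : A.mul (A.mul (A.e - u) v) (A.conj v) = A.N v • (A.e - u) :=
      A.op.conj_mul_mul v (A.e - u)
    rw [map_smul, LinearMap.smul_apply, h, smul_smul, inv_mul_cancel₀ hv, one_smul,
      add_sub_cancel, A.N_one]
    exact one_ne_zero
  by_cases huv : A.mul u v = 0
  swap
  · obtain ⟨a, ha⟩ := A.exists_polar_ne_zero huv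
    refine shift a ?_
    have h : polar A.N u (A.mul a (A.conj v)) = polar A.N (A.mul u v) a :=
      (A.op.polar_mul_left v u a).symm
    rwa [QuadraticMap.map_add A.N, hu, h, A.N_mul, A.N_conj, hv, mul_zero, zero_add, zero_add]
  by_cases hu0 : u = 0
  swap
  · exact ⟨u, hu0, A.conjugate_of_mul_eq_zero hu0 huv⟩
  subst hu0
  have hv0 : A.conj v ≠ 0 := fun h => hx <| by
    rw [← A.conj_conj v, h, map_zero, Prod.mk_zero_zero]
  have h := A.conjugate_add_mul_conj A.e 0 v
  rw [A.one_mul, zero_add] at h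
  refine ⟨_, hv0, h.symm.trans (A.conjugate_of_mul_eq_zero hv0 ?_)⟩
  simpa [A.mul_one, hv] using A.conj_mul_mul v A.e

theorem lam_apply (A : OctonionAlgebra O) (x y : O × O) :
    lam A x y = (2⁻¹ : ℂ) • (kap A (x + y) - kap A x - kap A y) := by
  ext
  · simp [lam, kap, polar]
  · simp [lam, kap]
    module
  · simp [lam, kap, polar]

theorem Conjugate.finrank_range_lam {A : OctonionAlgebra O} {x y : O × O}
    (hxy : A.Conjugate x y) :
    finrank ℂ (LinearMap.range (lam A x)) = finrank ℂ (LinearMap.range (lam A y)) := by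
  obtain ⟨g, h, rfl, H⟩ := hxy
  have key : (lam A (g y)).comp g.toLinearMap = h.toLinearMap.comp (lam A y) := by
    refine LinearMap.ext fun z => ?_
    simp [lam_apply, ← map_add, H]
  rw [← LinearMap.range_comp_of_range_eq_top (lam A (g y)) (LinearEquiv.range g), key,
    LinearMap.range_comp]
  exact h.finrank_map_eq _

theorem finrank_range_lam_left [FiniteDimensional ℂ O] (A : OctonionAlgebra O) {u : O}
    (hu : u ≠ 0) : finrank ℂ (LinearMap.range (lam A (u, 0))) =
      finrank ℂ (LinearMap.range (A.mul u)) + 1 := by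
  let f : ℂ × LinearMap.range (A.mul u) →ₗ[ℂ] ℂ × O × ℂ :=
    LinearMap.prodMap .id ((LinearMap.inl ℂ O ℂ).comp (Submodule.subtype _))
  have hf : Function.Injective f := by
    rintro ⟨s, w⟩ ⟨t, z⟩ h
    simpa [f] using h
  have hr : LinearMap.range (lam A (u, 0)) = LinearMap.range f := by
    apply le_antisymm
    · rintro _ ⟨⟨a, b⟩, rfl⟩
      exact ⟨(2⁻¹ * polar A.N u a, ⟨A.mul u ((2⁻¹ : ℂ) • b), _, rfl⟩), by simp [f, lam]⟩
    · rintro _ ⟨⟨t, _, b, rfl⟩, rfl⟩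
      obtain ⟨z, hz⟩ := A.exists_polar_ne_zero hu
      refine ⟨((2 * t * (polar A.N u z)⁻¹) • z, (2 : ℂ) • b), ?_⟩
      simp [f, lam, smul_smul]
      field_simp
  rw [hr, LinearMap.finrank_range_of_inj hf, finrank_prod, finrank_self, add_comm]

end OctonionAlgebra

/-- Identify the half-spin representation of `Spin₁₀` with `𝕆 ⊕ 𝕆` and the
vector representation with `ℂ ⊕ 𝕆 ⊕ ℂ`, with equivariant quadratic map
`κ(u,v) = (N(u), uv, N(v))`.  For nonzero `x ∈ 𝕆 ⊕ 𝕆`: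
(a) `κ(x) = 0` iff `x` has rank one, i.e. `x` lies in the orbit of some `(u,0)` with
`N(u) = 0` under the group of linear automorphisms commuting with `κ` (the image of
`Spin₁₀ × ℂ*`);
(b) the polarized map `λ(x) = κ̃(x,·)` has rank `5` if `x` has rank one (`κ(x) = 0`), and
rank `9` otherwise. -/
theorem stmt12 [FiniteDimensional ℂ O] (A : OctonionAlgebra O) :
    ∀ x : O × O, x ≠ 0 →
      ((kap A x = 0 ↔ ∃ (g : (O × O) ≃ₗ[ℂ] (O × O)) (h : (ℂ × O × ℂ) ≃ₗ[ℂ] (ℂ × O × ℂ))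
          (u : O), A.N u = 0 ∧ x = g (u, 0) ∧ ∀ y : O × O, kap A (g y) = h (kap A y)) ∧
       (kap A x = 0 → Module.finrank ℂ ↥(LinearMap.range (lam A x)) = 5) ∧
       (kap A x ≠ 0 → Module.finrank ℂ ↥(LinearMap.range (lam A x)) = 9)) := by
  intro x hx
  obtain ⟨u, hu, hxu⟩ := A.exists_conjugate_left hx
  have hk : kap A x = 0 ↔ A.N u = 0 := by
    obtain ⟨g, h, rfl, H⟩ := hxu
    rw [H, LinearEquiv.map_eq_zero_iff]
    simp [kap]
  rw [hxu.finrank_range_lam, A.finrank_range_lam_left hu, Ne, hk]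
  refine ⟨⟨fun hN => ?_, ?_⟩, fun hN => ?_, fun hN => ?_⟩
  · obtain ⟨g, h, hgx, H⟩ := hxu
    exact ⟨g, h, u, hN, hgx, H⟩
  · rintro ⟨g, h, w, hw, rfl, H⟩
    rw [← hk, H, LinearEquiv.map_eq_zero_iff]
    simp [kap, hw]
  · rw [A.finrank_range_mul_of_N_eq_zero hu hN]
  · rw [A.finrank_range_mul_of_N_ne_zero hN]
end
end

section
/- Let O be the complexified octonion algebra with norm N. Let x = (1,0) and y = (a,b) in O ⊕ O with b ≠ 0, and suppose every nontrivial linear combination of x and y has rank 2 (nonvanishing κ, where κ(u,v) = (N(u), uv, N(v))). Then the intersection of the kernels of the polarized maps λ(x) and λ(y) (from O ⊕ O to C ⊕ O ⊕ C) has dimension at most 3. -/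
noncomputable section

variable {O : Type*} [AddCommGroup O] [Module ℂ O]

theorem OctonionAlgebra.polar_mul_mul (A : OctonionAlgebra O) (u v w : O) :
    QuadraticMap.polar A.N (A.mul u v) (A.mul u w) = A.N u * QuadraticMap.polar A.N v w := by
  simp only [QuadraticMap.polar, ← map_add, A.N_mul]
  ring

theorem OctonionAlgebra.norm_eq_zero_of_mul_eq_zero (A : OctonionAlgebra O) {u b : O} (hb : b ≠ 0)
    (h : A.mul u b = 0) : A.N u = 0 := by
  by_contra hu
  refine hb (A.nondeg.1 b fun w => ?_)
  have := A.polar_mul_mul u b w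
  rw [h, QuadraticMap.polar_zero_left] at this
  simpa [hu] using this.symm

theorem OctonionAlgebra.finrank_isotropic_le [FiniteDimensional ℂ O] (A : OctonionAlgebra O)
    (W : Submodule ℂ O) (hN : ∀ u ∈ W, A.N u = 0)
    (he : ∀ u ∈ W, QuadraticMap.polar A.N A.e u = 0) : Module.finrank ℂ W ≤ 3 := by
  have horth := LinearMap.BilinForm.finrank_orthogonal A.nondeg W
  have hlt : W < LinearMap.BilinForm.orthogonal (QuadraticMap.polarBilin A.N) W := by
    refine SetLike.lt_iff_le_and_exists.2 ⟨fun x hx y hy => ?_, A.e, fun y hy => ?_, fun h => ?_⟩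
    · simp [QuadraticMap.polar, hN _ hx, hN _ hy, hN _ (W.add_mem hy hx)]
    · simpa [QuadraticMap.polar_comm A.N y] using he y hy
    · simpa [A.N_one] using hN _ h
  have := Submodule.finrank_lt_finrank_of_lt hlt
  have := A.dim_eq
  omega

/-- Let `𝕆` be the complexified octonion algebra with norm `N`.  Let
`x = (1,0)` and `y = (a,b)` in `𝕆 ⊕ 𝕆` with `b ≠ 0`, and suppose every nontrivial linear
combination of `x` and `y` has rank 2, i.e. nonvanishing `κ`, where
`κ(u,v) = (N(u), uv, N(v))`.  Then `Ker λ(x) ∩ Ker λ(y)` has dimension at most 3, where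
`λ(x) = κ̃(x,·)` is the polarized map `𝕆 ⊕ 𝕆 → ℂ ⊕ 𝕆 ⊕ ℂ`. -/
theorem stmt13 [FiniteDimensional ℂ O] (A : OctonionAlgebra O)
    (a b : O) (hb : b ≠ 0)
    (hrank2 : ∀ c d : ℂ, ¬(c = 0 ∧ d = 0) →
      kap A (c • ((A.e, 0) : O × O) + d • ((a, b) : O × O)) ≠ 0) :
    Module.finrank ℂ
      ↥(LinearMap.ker (lam A ((A.e, 0) : O × O)) ⊓ LinearMap.ker (lam A ((a, b) : O × O)))
      ≤ 3 := by
  have hK : ∀ p ∈ LinearMap.ker (lam A ((A.e, 0) : O × O)) ⊓ LinearMap.ker (lam A ((a, b) : O × O)),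
      QuadraticMap.polar A.N A.e p.1 = 0 ∧ p.2 = 0 ∧ A.mul p.1 b = 0 := by
    rintro ⟨u, v⟩ ⟨h₁, h₂⟩
    simp only [SetLike.mem_coe, LinearMap.mem_ker] at h₁ h₂
    obtain ⟨he, hv⟩ : QuadraticMap.polar A.N A.e u = 0 ∧ v = 0 := by
      simpa [lam, A.one_mul] using h₁
    subst hv
    exact ⟨he, rfl, by simpa [lam] using congrArg (fun z => z.2.1) h₂⟩
  generalize LinearMap.ker (lam A ((A.e, 0) : O × O)) ⊓ LinearMap.ker (lam A ((a, b) : O × O)) = K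
    at hK
  have hinj : Function.Injective ((LinearMap.fst ℂ O O).domRestrict K) := fun p q h =>
    Subtype.ext (Prod.ext h ((hK p p.2).2.1.trans (hK q q.2).2.1.symm))
  rw [← LinearMap.finrank_range_of_inj hinj]
  apply A.finrank_isotropic_le
  · rintro _ ⟨p, rfl⟩
    exact A.norm_eq_zero_of_mul_eq_zero hb (hK p p.2).2.2
  · rintro _ ⟨p, rfl⟩
    exact (hK p p.2).1
end
end
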